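/- arXiv:2403.04186 — 2 statements merged into one kernel-verified Lean document; each statement's English description precedes it below -/
import Mathlib

section
/- For all w ∈ 𝔥 = ℚ⟨x,y⟩, writing z := x + y, one has y ⋄ R(wy) − R(y ⋄ wy) = w((z+y)y − 2yz)y, that is, y ⋄ R(wy) − R(y ⋄ wy) = w(zy² − 2yzy + y³). (Note y ⋄ wy ∈ 𝔥y, so R(y ⋄ wy) is defined.) -/
/-- The generator `x` of `𝔥 = ℚ⟨x,y⟩`. -/
noncomputable def x : FreeAlgebra ℚ (Fin 2) := FreeAlgebra.ι ℚ 0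

/-- The generator `y` of `𝔥 = ℚ⟨x,y⟩`. -/
noncomputable def y : FreeAlgebra ℚ (Fin 2) := FreeAlgebra.ι ℚ 1

theorem decomp_aux (w : FreeAlgebra ℚ (Fin 2)) :
    ∃ (c : ℚ) (a b : FreeAlgebra ℚ (Fin 2)), w = c • 1 + a * x + b * y := by
  induction w using FreeAlgebra.induction with
  | grade0 r => exact ⟨r, 0, 0, by simp [Algebra.algebraMap_eq_smul_one]⟩
  | grade1 i =>
    fin_cases i
    · exact ⟨0, 1, 0, by simp [x]⟩
    · exact ⟨0, 0, 1, by simp [y]⟩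
  | mul u v hu hv =>
    obtain ⟨c, a, b, h⟩ := hu
    obtain ⟨c2, a2, b2, h2⟩ := hv
    refine ⟨c2 * c, c2 • a + u * a2, c2 • b + u * b2, ?_⟩
    have : u * v = c2 • u + u * a2 * x + u * b2 * y := by
      rw [h2]; simp [mul_add, mul_assoc]
    rw [this]
    nth_rewrite 1 [h]
    simp only [smul_add, smul_smul, add_mul, smul_mul_assoc]
    abel
  | add u v hu hv =>
    obtain ⟨c, a, b, h⟩ := hu
    obtain ⟨c2, a2, b2, h2⟩ := hv
    refine ⟨c + c2, a + a2, b + b2, ?_⟩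
    rw [h, h2]
    simp only [add_smul, add_mul]
    abel

/-- With `z := x + y`, `y ⋄ R(wy) − R(y ⋄ wy) = w((z+y)y − 2yz)y`.
Here `D` is any `ℚ`-bilinear map satisfying the defining recursion of `⋄`, and
`R` is any `ℚ`-linear map satisfying `R(1) = y` and `R(wy) = w(x+2y)y`. -/
theorem diamond_R_commutator
    (D : FreeAlgebra ℚ (Fin 2) →ₗ[ℚ] FreeAlgebra ℚ (Fin 2) →ₗ[ℚ] FreeAlgebra ℚ (Fin 2))
    (hone_right : ∀ w, D w 1 = w)
    (hone_left : ∀ w, D 1 w = w)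
    (hxx : ∀ v w, D (v * x) (w * x) = D v (w * x) * x - D (v * y) w * x)
    (hxy : ∀ v w, D (v * x) (w * y) = D v (w * y) * x + D (v * x) w * y)
    (hyx : ∀ v w, D (v * y) (w * x) = D v (w * x) * y + D (v * y) w * x)
    (hyy : ∀ v w, D (v * y) (w * y) = D v (w * y) * y - D (v * x) w * y)
    (R : Module.End ℚ (FreeAlgebra ℚ (Fin 2)))
    (hR1 : R 1 = y)
    (hRy : ∀ w : FreeAlgebra ℚ (Fin 2), R (w * y) = w * (x + 2 * y) * y) :
    ∀ w : FreeAlgebra ℚ (Fin 2),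
      D y (R (w * y)) - R (D y (w * y)) =
        w * (((x + y) + y) * y - 2 * y * (x + y)) * y := by
  have hxx1 := hxx 1
  have hxy1 := hxy 1
  have hyx1 := hyx 1
  have hyy1 := hyy 1
  simp only [one_mul, hone_left] at hxx1 hxy1 hyx1 hyy1
  have hz : ∀ w, D y w = w * x + w * y - D x w := by
    intro w
    obtain ⟨c, a, b, rfl⟩ := decomp_aux w
    simp only [map_add, map_smul, hone_right, hxx1, hxy1, hyx1, hyy1, add_mul,
      smul_mul_assoc, one_mul]
    abel
  intro w
  have e : w * (x + 2 * y) * y = (w * x) * y + (2 : ℚ) • ((w * y) * y) := by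
    rw [two_mul, two_smul]; noncomm_ring
  have e2 : R (D y (w * y)) = (w * y - D x w) * (x + 2 * y) * y := by
    rw [hyy1, ← sub_mul, hRy]
  rw [e2, hRy, e, map_add, map_smul, hyy1, hyy1, hxx1, hxy1, hz, two_smul, two_mul]
  noncomm_ring
end

section
/- For all integers a, b ≥ 0 one has, in 𝔥 = ℚ⟨x,y⟩ with z := x + y: R^a(1) ⋄ R^b(1) = Σ over all r ≥ 0 and all compositions (k_1, …, k_r) of a + b (integers k_i ≥ 1 with k_1 + … + k_r = a + b; the empty composition r = 0 occurring only when a + b = 0, contributing 1) of c_{(k_1,…,k_r)}(a,b) · z^{k_1−1}y ⋯ z^{k_r−1}y, where c_{(k_1,…,k_r)}(a,b) ∈ ℤ is the coefficient of X^a Y^b in the product Π_{i=1}^r (X^{k_i} + Y^{k_i} − Σ_{n=1}^{k_i−1} X^n Y^{k_i−n}) in ℚ[X,Y]. -/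
/-- `f(k) := X^k + Y^k − Σ_{n=1}^{k−1} X^n Y^{k−n}` in `ℚ[X,Y]`,
where `X := MvPolynomial.X 0` and `Y := MvPolynomial.X 1`. -/
noncomputable def f (k : ℕ) : MvPolynomial (Fin 2) ℚ :=
  MvPolynomial.X 0 ^ k + MvPolynomial.X 1 ^ k -
    ∑ n ∈ Finset.Ico 1 k, MvPolynomial.X 0 ^ n * MvPolynomial.X 1 ^ (k - n)

/-- Induction on the free algebra by right multiplication with generators. -/
theorem right_induction (P : FreeAlgebra ℚ (Fin 2) → Prop) (h1 : P 1)
    (hx : ∀ v, P v → P (v * x)) (hy : ∀ v, P v → P (v * y))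
    (hadd : ∀ v w, P v → P w → P (v + w)) (hsmul : ∀ (r : ℚ) v, P v → P (r • v)) :
    ∀ w, P w := by
  have key : ∀ w : FreeAlgebra ℚ (Fin 2), ∀ v, P v → P (v * w) := by
    intro w
    induction w using FreeAlgebra.induction with
    | grade0 r =>
      intro v hv
      rw [← Algebra.commutes, ← Algebra.smul_def]
      exact hsmul r v hv
    | grade1 i =>
      intro v hv
      fin_cases i
      · exact hx v hv
      · exact hy v hv
    | mul a b ha hb =>
      intro v hv
      rw [← mul_assoc]
      exact hb _ (ha _ hv)
    | add a b ha hb =>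
      intro v hv
      rw [mul_add]
      exact hadd _ _ (ha _ hv) (hb _ hv)
  intro w
  simpa using key w 1 h1

/-- Decomposition of a sum over compositions according to the last block. -/
theorem sum_composition_succ {M : Type*} [AddCommMonoid M] (n : ℕ) (φ : List ℕ → M) :
    ∑ c : Composition (n + 1), φ c.blocks =
      ∑ i ∈ Finset.range (n + 1), ∑ c : Composition (n - i), φ (c.blocks ++ [i + 1]) := by
  rw [Finset.sum_range (fun i => ∑ c : Composition (n - i), φ (c.blocks ++ [i + 1]))]
  rw [← Fintype.sum_sigma' (fun (i : Fin (n + 1)) (c : Composition (n - i)) =>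
    φ (c.blocks ++ [(i : ℕ) + 1]))]
  symm
  let e : (Σ i : Fin (n + 1), Composition (n - i)) → Composition (n + 1) := fun p =>
    { blocks := p.2.blocks ++ [(p.1 : ℕ) + 1]
      blocks_pos := by
        intro j hj
        rcases List.mem_append.1 hj with h | h
        · exact p.2.blocks_pos h
        · simp at h; omega
      blocks_sum := by
        have := p.1.2
        simp [p.2.blocks_sum]; omega }
  refine Fintype.sum_bijective e ⟨?_, ?_⟩ _ _ (fun p => rfl)
  · rintro ⟨i, c⟩ ⟨j, d⟩ h
    have h' : c.blocks ++ [(i : ℕ) + 1] = d.blocks ++ [(j : ℕ) + 1] :=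
      congrArg Composition.blocks h
    have h2 := List.append_inj' h' rfl
    have hij : i = j := by
      have := h2.2
      simp at this
      exact Fin.ext this
    subst hij
    have : c = d := Composition.ext h2.1
    rw [this]
  · intro c
    have hne : c.blocks ≠ [] := by
      intro h
      have := c.blocks_sum
      rw [h] at this
      simp at this
    have hcat := List.dropLast_append_getLast hne
    have hpos : 0 < c.blocks.getLast hne := c.blocks_pos (List.getLast_mem hne)
    have hsum : c.blocks.dropLast.sum + c.blocks.getLast hne = n + 1 := by
      have := c.blocks_sum
      rw [← hcat] at this
      simpa using this
    refine ⟨⟨⟨c.blocks.getLast hne - 1, by omega⟩, ⟨c.blocks.dropLast, ?_, ?_⟩⟩, ?_⟩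
    · intro i hi
      exact c.blocks_pos (List.mem_of_mem_dropLast hi)
    · simp only; omega
    · apply Composition.ext
      show c.blocks.dropLast ++ [c.blocks.getLast hne - 1 + 1] = c.blocks
      rw [Nat.sub_add_cancel hpos]
      exact hcat

/-- The exponent of `XᵃYᵇ`. -/
noncomputable def dd (a b : ℕ) : Fin 2 →₀ ℕ := Finsupp.single 0 a + Finsupp.single 1 b

theorem coeff_mul_XY (P : MvPolynomial (Fin 2) ℚ) (a b i j : ℕ) :
    MvPolynomial.coeff (dd a b) (P * (MvPolynomial.X 0 ^ i * MvPolynomial.X 1 ^ j)) =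
      if i ≤ a ∧ j ≤ b then MvPolynomial.coeff (dd (a - i) (b - j)) P else 0 := by
  have hm : (MvPolynomial.X 0 ^ i * MvPolynomial.X 1 ^ j : MvPolynomial (Fin 2) ℚ) =
      MvPolynomial.monomial (dd i j) 1 := by
    rw [MvPolynomial.X_pow_eq_monomial, MvPolynomial.X_pow_eq_monomial,
      MvPolynomial.monomial_mul, dd, one_mul]
  rw [hm, MvPolynomial.coeff_mul_monomial']
  have h1 : dd i j ≤ dd a b ↔ i ≤ a ∧ j ≤ b := by
    rw [Finsupp.le_def, Fin.forall_fin_two]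
    simp [dd]
  have h2 : dd a b - dd i j = dd (a - i) (b - j) := by
    ext t
    fin_cases t <;> simp [dd]
  simp only [h1, h2, mul_one]

/-- The composition sum, with the total degree decoupled. -/
noncomputable def SS (n a b : ℕ) : FreeAlgebra ℚ (Fin 2) :=
  ∑ c : Composition n, MvPolynomial.coeff (dd a b) ((c.blocks.map f).prod) •
    (c.blocks.map fun k => (x + y) ^ (k - 1) * y).prod

theorem coeff_mul_f (P : MvPolynomial (Fin 2) ℚ) (a b k : ℕ) :
    MvPolynomial.coeff (dd a b) (P * f (k + 1)) =
      (if k < a then MvPolynomial.coeff (dd (a - 1 - k) b) P else 0) +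
      (if k < b then MvPolynomial.coeff (dd a (b - 1 - k)) P else 0) -
      ∑ m ∈ Finset.range k, if m < a ∧ k - 1 - m < b then
        MvPolynomial.coeff (dd (a - 1 - m) (b - 1 - (k - 1 - m))) P else 0 := by
  have hX := coeff_mul_XY P a b (k + 1) 0
  have hY := coeff_mul_XY P a b 0 (k + 1)
  simp only [pow_zero, mul_one, one_mul, Nat.zero_le, and_true, true_and, Nat.sub_zero] at hX hY
  rw [f, mul_sub, mul_add, MvPolynomial.coeff_sub, MvPolynomial.coeff_add, hX, hY,
    Finset.mul_sum, MvPolynomial.coeff_sum, Finset.sum_Ico_eq_sum_range]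
  simp only [coeff_mul_XY, Nat.add_sub_cancel]
  congr 1
  · congr 1
    · simp only [Nat.succ_le_iff, Nat.sub_sub, Nat.add_comm]
    · simp only [Nat.succ_le_iff, Nat.sub_sub, Nat.add_comm]
  · apply Finset.sum_congr rfl
    intro m hm
    have hm := Finset.mem_range.1 hm
    have e1 : (1 + m ≤ a ∧ k + 1 - (1 + m) ≤ b) ↔ (m < a ∧ k - 1 - m < b) := by omega
    have e2 : a - (1 + m) = a - 1 - m := by omega
    have e3 : b - (k + 1 - (1 + m)) = b - 1 - (k - 1 - m) := by omega
    simp only [e1, e2, e3]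

theorem SS_succ (n a b : ℕ) :
    SS (n + 1) a b = ∑ k ∈ Finset.range (n + 1),
      ((if k < a then SS (n - k) (a - 1 - k) b else 0) +
      (if k < b then SS (n - k) a (b - 1 - k) else 0) -
      ∑ m ∈ Finset.range k, if m < a ∧ k - 1 - m < b then
        SS (n - k) (a - 1 - m) (b - 1 - (k - 1 - m)) else 0) * ((x + y) ^ k * y) := by
  rw [SS, sum_composition_succ n (fun l => MvPolynomial.coeff (dd a b) ((l.map f).prod) •
    (l.map fun k => (x + y) ^ (k - 1) * y).prod)]
  apply Finset.sum_congr rfl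
  intro k _
  simp only [List.map_append, List.prod_append, List.map_cons, List.map_nil, List.prod_cons,
    List.prod_nil, mul_one, Nat.add_sub_cancel, coeff_mul_f]
  simp only [← smul_mul_assoc]
  rw [← Finset.sum_mul]
  congr 1
  simp only [sub_smul, add_smul, Finset.sum_sub_distrib, Finset.sum_add_distrib, Finset.sum_smul]
  congr 1
  · congr 1
    · split_ifs <;> simp [SS]
    · split_ifs <;> simp [SS]
  · rw [Finset.sum_comm]
    apply Finset.sum_congr rfl
    intro m _
    split_ifs <;> simp [SS]

theorem sum_range_ite_lt {M : Type*} [AddCommMonoid M] (a N : ℕ) (h : a ≤ N) (g : ℕ → M) :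
    ∑ k ∈ Finset.range N, (if k < a then g k else 0) = ∑ k ∈ Finset.range a, g k := by
  rw [← Finset.sum_filter]
  congr 1
  ext k
  simp only [Finset.mem_filter, Finset.mem_range]
  omega

theorem sum_double {M : Type*} [AddCommMonoid M] (a b n : ℕ) (h : a + b = n + 1)
    (g : ℕ → ℕ → M) :
    ∑ k ∈ Finset.range (n + 1), ∑ m ∈ Finset.range k,
      (if m < a ∧ k - 1 - m < b then g m (k - 1 - m) else 0) =
    ∑ i ∈ Finset.range a, ∑ j ∈ Finset.range b, g i j := by
  rw [Finset.sum_sigma', Finset.sum_sigma', ← Finset.sum_filter]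
  refine Finset.sum_bij' (fun p _ => ⟨p.2, p.1 - 1 - p.2⟩) (fun p _ => ⟨p.1 + p.2 + 1, p.1⟩)
    ?_ ?_ ?_ ?_ ?_
  · rintro ⟨k, m⟩ hp
    simp only [Finset.mem_filter, Finset.mem_sigma, Finset.mem_range] at hp ⊢
    omega
  · rintro ⟨k, m⟩ hp
    simp only [Finset.mem_filter, Finset.mem_sigma, Finset.mem_range] at hp ⊢
    omega
  · rintro ⟨k, m⟩ hp
    simp only [Finset.mem_filter, Finset.mem_sigma, Finset.mem_range] at hp
    have : m + (k - 1 - m) + 1 = k := by omega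
    simp only [this]
  · rintro ⟨k, m⟩ hp
    have : k + m + 1 - 1 - k = m := by omega
    simp only [this]
  · rintro ⟨k, m⟩ hp
    rfl

theorem add_sub_congr {M : Type*} [AddCommGroup M] {a a' b b' c c' : M} (h1 : a = a')
    (h2 : b = b') (h3 : c = c') : a + b - c = a' + b' - c' := by
  rw [h1, h2, h3]

theorem SS_rec (n a b : ℕ) (h : a + b = n + 1) :
    SS (n + 1) a b =
      ∑ i ∈ Finset.range a, SS (a - 1 - i + b) (a - 1 - i) b * ((x + y) ^ i * y) +
      ∑ j ∈ Finset.range b, SS (a + (b - 1 - j)) a (b - 1 - j) * ((x + y) ^ j * y) -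
      ∑ i ∈ Finset.range a, ∑ j ∈ Finset.range b,
        SS (a - 1 - i + (b - 1 - j)) (a - 1 - i) (b - 1 - j) * ((x + y) ^ (i + j + 1) * y) := by
  rw [SS_succ]
  simp only [sub_mul, add_mul, Finset.sum_sub_distrib, Finset.sum_add_distrib, Finset.sum_mul,
    ite_mul, zero_mul]
  rw [sum_range_ite_lt a _ (by omega), sum_range_ite_lt b _ (by omega),
    ← sum_double a b n h]
  refine add_sub_congr ?_ ?_ ?_
  · apply Finset.sum_congr rfl
    intro i hi
    have hi := Finset.mem_range.1 hi
    have : n - i = a - 1 - i + b := by omega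
    rw [this]
  · apply Finset.sum_congr rfl
    intro i hi
    have hi := Finset.mem_range.1 hi
    have : n - i = a + (b - 1 - i) := by omega
    rw [this]
  · apply Finset.sum_congr rfl
    intro k hk
    apply Finset.sum_congr rfl
    intro m hm
    have hm := Finset.mem_range.1 hm
    split_ifs with hc
    · have e1 : n - k = a - 1 - m + (b - 1 - (k - 1 - m)) := by omega
      have e2 : m + (k - 1 - m) + 1 = k := by omega
      rw [e1, e2]
    · rfl

theorem SS_zero : SS 0 0 0 = 1 := by
  have hb : ∀ c : Composition 0, c.blocks = [] := by
    intro c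
    apply List.eq_nil_of_length_eq_zero
    have h := c.length_le
    rw [Composition.blocks_length]
    omega
  have hcard : Fintype.card (Composition 0) = 1 := by
    rw [composition_card]
    rfl
  rw [SS]
  simp only [hb]
  rw [Finset.sum_const, Finset.card_univ, hcard]
  simp [dd]

set_option maxHeartbeats 2000000 in
/-- For `a, b ≥ 0`, writing `z := x + y`:
`Rᵃ(1) ⋄ Rᵇ(1) = Σ_{(k₁,…,k_r) composition of a+b} c_{(k₁,…,k_r)}(a,b) · z^{k₁−1}y ⋯ z^{k_r−1}y`,
where `c_{(k₁,…,k_r)}(a,b)` is the coefficient of `XᵃYᵇ` in `Π_i f(kᵢ)`.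
Here `D` is any `ℚ`-bilinear map satisfying the defining recursion of `⋄`, and
`R` is any `ℚ`-linear map satisfying `R(1) = y` and `R(wy) = w(x+2y)y`. -/
theorem diamond_R_pow_one_eq_sum_compositions
    (D : FreeAlgebra ℚ (Fin 2) →ₗ[ℚ] FreeAlgebra ℚ (Fin 2) →ₗ[ℚ] FreeAlgebra ℚ (Fin 2))
    (hone_right : ∀ w, D w 1 = w)
    (hone_left : ∀ w, D 1 w = w)
    (hxx : ∀ v w, D (v * x) (w * x) = D v (w * x) * x - D (v * y) w * x)
    (hxy : ∀ v w, D (v * x) (w * y) = D v (w * y) * x + D (v * x) w * y)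
    (hyx : ∀ v w, D (v * y) (w * x) = D v (w * x) * y + D (v * y) w * x)
    (hyy : ∀ v w, D (v * y) (w * y) = D v (w * y) * y - D (v * x) w * y)
    (R : Module.End ℚ (FreeAlgebra ℚ (Fin 2)))
    (hR1 : R 1 = y)
    (hRy : ∀ w : FreeAlgebra ℚ (Fin 2), R (w * y) = w * (x + 2 * y) * y) :
    ∀ a b : ℕ,
      D ((R ^ a) 1) ((R ^ b) 1) =
        ∑ c : Composition (a + b),
          MvPolynomial.coeff (Finsupp.single 0 a + Finsupp.single 1 b)
              ((c.blocks.map f).prod) •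
            (c.blocks.map fun k => (x + y) ^ (k - 1) * y).prod := by
  have hzl : ∀ v w, D (v * (x + y)) w = D v w * (x + y) := by
    intro v
    apply right_induction
    · simp [hone_right]
    · intro w _
      rw [mul_add, map_add, LinearMap.add_apply, hxx, hyx, mul_add]
      abel
    · intro w _
      rw [mul_add, map_add, LinearMap.add_apply, hxy, hyy, mul_add]
      abel
    · intro w w' h h'
      rw [map_add, map_add, h, h', add_mul]
    · intro r w h
      rw [map_smul, map_smul, h, smul_mul_assoc]
  have hzr : ∀ v w, D v (w * (x + y)) = D v w * (x + y) := by
    intro v w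
    revert v
    apply right_induction
    · simp [hone_left]
    · intro v hv
      have e : D v w * (x + y) = D (v * x) w + D (v * y) w := by
        rw [← hzl, mul_add, map_add, LinearMap.add_apply]
      have e2 : D v (w * x) + D v (w * y) = D v w * (x + y) := by
        rw [← hv, mul_add, map_add]
      have e3 : D v (w * y) = D (v * x) w + D (v * y) w - D v (w * x) := by
        rw [← e, ← e2]; abel
      rw [mul_add, map_add, hxx, hxy, e3]
      noncomm_ring
    · intro v hv
      have e : D v w * (x + y) = D (v * x) w + D (v * y) w := by
        rw [← hzl, mul_add, map_add, LinearMap.add_apply]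
      have e2 : D v (w * x) + D v (w * y) = D v w * (x + y) := by
        rw [← hv, mul_add, map_add]
      have e3 : D v (w * y) = D (v * x) w + D (v * y) w - D v (w * x) := by
        rw [← e, ← e2]; abel
      rw [mul_add, map_add, hyx, hyy, e3]
      noncomm_ring
    · intro v v' h h'
      rw [map_add, LinearMap.add_apply, LinearMap.add_apply, h, h', add_mul]
    · intro r v h
      rw [map_smul, LinearMap.smul_apply, LinearMap.smul_apply, h, smul_mul_assoc]
  have hzlp : ∀ k v w, D (v * (x + y) ^ k) w = D v w * (x + y) ^ k := by
    intro k
    induction k with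
    | zero => simp
    | succ k ih => intro v w; rw [pow_succ, ← mul_assoc, hzl, ih, mul_assoc]
  have hzrp : ∀ k v w, D v (w * (x + y) ^ k) = D v w * (x + y) ^ k := by
    intro k
    induction k with
    | zero => simp
    | succ k ih => intro v w; rw [pow_succ, ← mul_assoc, hzr, ih, mul_assoc]
  have hyy' : ∀ v w, D (v * y) (w * y) =
      D v (w * y) * y + D (v * y) w * y - D v w * (x + y) * y := by
    intro v w
    have e : D v w * (x + y) = D (v * x) w + D (v * y) w := by
      rw [← hzl, mul_add, map_add, LinearMap.add_apply]
    rw [hyy, e, add_mul]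
    abel
  -- the elements `A a = R^a 1`
  obtain ⟨A, hA⟩ : ∃ A : ℕ → FreeAlgebra ℚ (Fin 2), ∀ a, A a = (R ^ a) 1 := ⟨_, fun _ => rfl⟩
  have hA0 : A 0 = 1 := by rw [hA]; simp
  have hA1 : ∀ a, A (a + 1) = (x + 2 * y) ^ a * y := by
    intro a
    induction a with
    | zero => rw [hA]; simp [hR1]
    | succ a ih =>
      rw [hA, pow_succ', Module.End.mul_apply, ← hA, ih, hRy, pow_succ]
  obtain ⟨B, hB⟩ : ∃ B : ℕ → FreeAlgebra ℚ (Fin 2),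
      ∀ a, B a = ∑ i ∈ Finset.range a, A (a - 1 - i) * (x + y) ^ i := ⟨_, fun _ => rfl⟩
  have hB0 : B 0 = 0 := by rw [hB]; simp
  have hBs : ∀ a, B (a + 1) = B a * (x + y) + A a := by
    intro a
    rw [hB, hB, Finset.sum_range_succ', Finset.sum_mul]
    congr 1
    · apply Finset.sum_congr rfl
      intro i _
      have : a + 1 - 1 - (i + 1) = a - 1 - i := by omega
      rw [this, pow_succ, mul_assoc]
    · simp
  have hBp : ∀ a, B (a + 1) = (x + 2 * y) ^ a := by
    intro a
    induction a with
    | zero => rw [hBs, hB0, hA0]; simp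
    | succ a ih =>
      rw [hBs, ih, hA1, pow_succ, ← mul_add]
      congr 1
      rw [two_mul, add_assoc]
  have hAB : ∀ a, A (a + 1) = B (a + 1) * y := by
    intro a; rw [hA1, hBp]
  have hDB : ∀ a w, D (B a) w = ∑ i ∈ Finset.range a, D (A (a - 1 - i)) w * (x + y) ^ i := by
    intro a w
    rw [hB, map_sum, LinearMap.sum_apply]
    simp only [hzlp]
  have hDB' : ∀ b v, D v (B b) = ∑ i ∈ Finset.range b, D v (A (b - 1 - i)) * (x + y) ^ i := by
    intro a w
    rw [hB, map_sum]
    simp only [hzrp]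
  have hrec : ∀ a b, a + b ≠ 0 → D (A a) (A b) =
      D (B a) (A b) * y + D (A a) (B b) * y - D (B a) (B b) * (x + y) * y := by
    intro a b hab
    rcases a with _ | a
    · rcases b with _ | b
      · exact absurd rfl hab
      · rw [hA0, hB0, hAB]
        simp [hone_left]
    · rcases b with _ | b
      · rw [hA0, hB0, hAB]
        simp [hone_right]
      · rw [hAB, hAB, hyy']
  have main : ∀ n a b, a + b = n → D (A a) (A b) = SS n a b := by
    intro n
    induction n using Nat.strong_induction_on with
    | _ n ih =>
      intro a b hab
      rcases n with _ | n
      · have ha : a = 0 := by omega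
        have hb : b = 0 := by omega
        subst ha hb
        rw [SS_zero, hA0, hone_left]
      · rw [SS_rec n a b hab, hrec a b (by omega), hDB, hDB', hDB]
        simp only [hDB', Finset.sum_mul]
        refine add_sub_congr ?_ ?_ ?_
        · apply Finset.sum_congr rfl
          intro i hi
          have hi := Finset.mem_range.1 hi
          rw [ih (a - 1 - i + b) (by omega) _ _ rfl, mul_assoc]
        · apply Finset.sum_congr rfl
          intro i hi
          have hi := Finset.mem_range.1 hi
          rw [ih (a + (b - 1 - i)) (by omega) _ _ rfl, mul_assoc]
        · apply Finset.sum_congr rfl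
          intro i hi
          have hi := Finset.mem_range.1 hi
          apply Finset.sum_congr rfl
          intro j hj
          have hj := Finset.mem_range.1 hj
          rw [ih (a - 1 - i + (b - 1 - j)) (by omega) _ _ rfl]
          have : i + j + 1 = j + i + 1 := by omega
          rw [this, pow_succ, pow_add]
          simp only [mul_assoc]
  intro a b
  rw [← hA, ← hA]
  exact main (a + b) a b rfl
end
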